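/- Lemma 5.2 (co-plane ball lemma). Let n ≥ 1 and R > δ > 0. There exist ε ∈ (0,1) and a natural number k₀ (both depending only on n, R and δ) such that for every integer k ≥ k₀ and all v', v̄', v_*, v̄_* ∈ ℝⁿ satisfying |v_*| ≤ R, |v̄_*| ≤ R, |v̄_* − v_*| ≥ δ, D := |v' − v_*|²|v̄' − v̄_*|² − ⟨v' − v_*, v̄' − v̄_*⟩² ≥ δ²(|v' − v_*|² + |v̄' − v̄_*|²), and d(v', v̄') ≤ ε 2^{-k}, the following holds: there exists w ∈ ℝⁿ with ⟨w − v', v' − v_*⟩ = 0 and ⟨w − v̄', v̄' − v̄_*⟩ = 0, such that every v ∈ ℝⁿ satisfying ⟨v − v', v' − v_*⟩ = 0, ⟨v − v̄', v̄' − v̄_*⟩ = 0 and |v − w| < (3/4)·2^{-k} also satisfies |v − v'| ≤ 2^{-k} and |v − v̄'| ≤ 2^{-k}. (That is, the set {v in the co-plane : |v−v'| ≤ 2^{-k} and |v−v̄'| ≤ 2^{-k}} is nonempty and contains the intersection of the co-plane with a Euclidean ball of radius (3/4)·2^{-k} centered at a point of the co-plane.) -/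

import Mathlib

open Real
open scoped RealInnerProductSpace

noncomputable section

/-- `ℝⁿ` with the Euclidean structure. -/
abbrev V (n : ℕ) := EuclideanSpace ℝ (Fin n)

/-- the anisotropic metric `d(v,v') = √(|v-v'|² + ¼(|v|²-|v'|²)²)`. -/
def anisoDist {n : ℕ} (v v' : V n) : ℝ :=
  Real.sqrt (‖v - v'‖ ^ 2 + 4⁻¹ * (‖v‖ ^ 2 - ‖v'‖ ^ 2) ^ 2)

theorem le_of_sq_le_sq_aux {x y : ℝ} (hy : 0 ≤ y) (h : x ^ 2 ≤ y ^ 2) : x ≤ y :=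
  (abs_le_of_sq_le_sq' h hy).2

theorem coplane_aux {n : ℕ} (a b : V n) (c δ : ℝ) (hδ : 0 < δ)
    (h : δ ^ 2 * (‖a‖ ^ 2 + ‖b‖ ^ 2) ≤ ‖a‖ ^ 2 * ‖b‖ ^ 2 - ⟪a, b⟫ ^ 2)
    (hc : b = 0 → c = 0) :
    ∃ x : V n, ⟪x, a⟫ = 0 ∧ ⟪x, b⟫ = c ∧ δ * ‖x‖ ≤ |c| := by
  by_cases hb : b = 0
  · refine ⟨0, ?_, ?_, ?_⟩ <;> simp [hc hb]
  have hb' : 0 < ‖b‖ ^ 2 := by positivity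
  set D := ‖a‖ ^ 2 * ‖b‖ ^ 2 - ⟪a, b⟫ ^ 2 with hD
  have hDpos : 0 < D := lt_of_lt_of_le (by positivity) h
  have hxx : ‖(‖a‖ ^ 2) • b - ⟪a, b⟫ • a‖ ^ 2 = ‖a‖ ^ 2 * D := by
    rw [← real_inner_self_eq_norm_sq]
    simp only [inner_sub_left, inner_sub_right, real_inner_smul_left, real_inner_smul_right,
      real_inner_comm a b]
    rw [real_inner_self_eq_norm_sq, real_inner_self_eq_norm_sq]
    rw [hD]; ring
  refine ⟨(c / D) • ((‖a‖ ^ 2) • b - ⟪a, b⟫ • a), ?_, ?_, ?_⟩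
  · simp only [inner_sub_left, real_inner_smul_left, real_inner_self_eq_norm_sq,
      real_inner_comm a b]
    ring
  · simp only [inner_sub_left, real_inner_smul_left, real_inner_self_eq_norm_sq]
    rw [div_mul_eq_mul_div, div_eq_iff hDpos.ne', hD]; ring
  · apply le_of_sq_le_sq_aux (abs_nonneg c)
    rw [norm_smul, mul_pow, mul_pow, hxx, sq_abs, norm_eq_abs, sq_abs]
    have h2 : δ ^ 2 * ‖a‖ ^ 2 ≤ D := by nlinarith [sq_nonneg δ]
    have : δ ^ 2 * ((c / D) ^ 2 * (‖a‖ ^ 2 * D)) = c ^ 2 * ((δ ^ 2 * ‖a‖ ^ 2) / D) := by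
      field_simp
    rw [this]
    exact mul_le_of_le_one_right (sq_nonneg c) ((div_le_one hDpos).2 h2)

/-- **Lemma 5.2 (co-plane ball lemma)**: under the non-degeneracy assumptions, if
`d(v', v̄') ≤ ε 2^{-k}` then the co-plane contains a point `w` such that the ball of
radius `(3/4)·2^{-k}` about `w` inside the co-plane consists of points that are
within `2^{-k}` of both `v'` and `v̄'`. -/
theorem coplane_ball_lemma
    (n : ℕ) (hn : 1 ≤ n) (R δ : ℝ) (hδ : 0 < δ) (hδR : δ < R) :
    ∃ ε : ℝ, ε ∈ Set.Ioo (0:ℝ) 1 ∧ ∃ k₀ : ℕ,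
      ∀ k : ℤ, (k₀ : ℤ) ≤ k →
      ∀ v' vb' vs vbs : V n, ‖vs‖ ≤ R → ‖vbs‖ ≤ R → δ ≤ ‖vbs - vs‖ →
        δ ^ 2 * (‖v' - vs‖ ^ 2 + ‖vb' - vbs‖ ^ 2) ≤
          ‖v' - vs‖ ^ 2 * ‖vb' - vbs‖ ^ 2 - ⟪v' - vs, vb' - vbs⟫ ^ 2 →
        anisoDist v' vb' ≤ ε * (2:ℝ) ^ (-k) →
        ∃ w : V n, ⟪w - v', v' - vs⟫ = 0 ∧ ⟪w - vb', vb' - vbs⟫ = 0 ∧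
          ∀ v : V n, ⟪v - v', v' - vs⟫ = 0 → ⟪v - vb', vb' - vbs⟫ = 0 →
            ‖v - w‖ < (3 / 4) * (2:ℝ) ^ (-k) →
            ‖v - v'‖ ≤ (2:ℝ) ^ (-k) ∧ ‖v - vb'‖ ≤ (2:ℝ) ^ (-k) := by
  have hR : 0 < R := hδ.trans hδR
  have hP : 0 < 16 * (2 + R) + 16 * δ := by positivity
  set ε := δ / (16 * (2 + R) + 16 * δ) with hε
  have hε0 : 0 < ε := by positivity
  have hεm : ε * (16 * (2 + R) + 16 * δ) = δ := by rw [hε]; field_simp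
  have hε1 : ε ≤ 1 / 16 := by
    rw [hε, div_le_iff₀ hP]; nlinarith
  refine ⟨ε, ⟨hε0, by linarith⟩, 0, ?_⟩
  intro k hk v' vb' vs vbs hvs hvbs _ hD hd
  set r : ℝ := (2:ℝ) ^ (-k) with hr
  have hr0 : 0 < r := by positivity
  have hr1 : r ≤ 1 := zpow_le_one_of_nonpos₀ (by norm_num) (by simpa using hk)
  have hm0 : 0 ≤ ε * r := by positivity
  have hm1 : ε * r ≤ 1 := by nlinarith
  have hsq : ‖v' - vb'‖ ^ 2 + 4⁻¹ * (‖v'‖ ^ 2 - ‖vb'‖ ^ 2) ^ 2 ≤ (ε * r) ^ 2 := by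
    unfold anisoDist at hd
    exact (Real.sqrt_le_left hm0).1 hd
  have he : ‖vb' - v'‖ ≤ ε * r := by
    rw [norm_sub_rev]
    apply le_of_sq_le_sq_aux hm0
    nlinarith [sq_nonneg (‖v'‖ ^ 2 - ‖vb'‖ ^ 2)]
  have hq : |‖vb'‖ ^ 2 - ‖v'‖ ^ 2| ≤ 2 * (ε * r) := by
    apply abs_le_of_sq_le_sq _ (by positivity)
    nlinarith [sq_nonneg ‖v' - vb'‖]
  have hc : |⟪vb' - v', vb' - vbs⟫| ≤ (2 + R) * (ε * r) := by
    have h1 : ⟪vb' - v', vb' - vbs⟫ =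
        (‖vb'‖ ^ 2 - ‖v'‖ ^ 2 + ‖vb' - v'‖ ^ 2) / 2 - ⟪vb' - v', vbs⟫ := by
      rw [inner_sub_right, norm_sub_sq_real, inner_sub_left vb' v' vb',
        real_inner_self_eq_norm_sq, real_inner_comm v' vb']
      ring
    have h2 : |⟪vb' - v', vbs⟫| ≤ (ε * r) * R :=
      (abs_real_inner_le_norm _ _).trans (by gcongr)
    have h3 : ‖vb' - v'‖ ^ 2 ≤ ε * r := by nlinarith [norm_nonneg (vb' - v')]
    have h4 := sq_nonneg ‖vb' - v'‖
    rw [h1]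
    rw [abs_le] at *
    constructor <;> nlinarith
  obtain ⟨x, hxa, hxb, hx⟩ := coplane_aux (v' - vs) (vb' - vbs) ⟪vb' - v', vb' - vbs⟫ δ hδ hD
    (fun h => by rw [h, inner_zero_right])
  have hx' : ‖x‖ ≤ r / 16 := by
    have h5 : δ * ‖x‖ ≤ δ * (r / 16) := by
      have : 0 ≤ ε * r * δ := by positivity
      calc δ * ‖x‖ ≤ (2 + R) * (ε * r) := hx.trans hc
        _ ≤ (ε * (16 * (2 + R) + 16 * δ)) * (r / 16) := by
          have h6 : (ε * (16 * (2 + R) + 16 * δ)) * (r / 16) =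
            (2 + R) * (ε * r) + ε * r * δ := by ring
          rw [h6]
          exact le_add_of_nonneg_right this
        _ = _ := by rw [hεm]
    exact le_of_mul_le_mul_left h5 hδ
  have he' : ‖vb' - v'‖ ≤ r / 16 := he.trans (by
    have := mul_le_mul_of_nonneg_right hε1 hr0.le
    linarith)
  refine ⟨v' + x, by simpa using hxa, ?_, ?_⟩
  · have : v' + x - vb' = x - (vb' - v') := by abel
    rw [this, inner_sub_left, hxb, sub_self]
  · intro v _ _ hv
    have e1 : v - v' = (v - (v' + x)) + x := by abel
    have n1 : ‖v - v'‖ ≤ ‖v - (v' + x)‖ + ‖x‖ := by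
      conv_lhs => rw [e1]
      exact norm_add_le _ _
    have e2 : v - vb' = (v - v') - (vb' - v') := by abel
    have n2 : ‖v - vb'‖ ≤ ‖v - v'‖ + ‖vb' - v'‖ := by
      conv_lhs => rw [e2]
      exact norm_sub_le _ _
    constructor <;> linarith
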